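/- Consider a combinatorial n-fold IP: let D ∈ ℤ^{r×t}, E = (D; 1ᵀ), b ∈ ℤ^{r+n}, l, u ∈ ℤ^{nt} with l ≤ u, and let f : ℝ^{nt} → ℝ be separable convex, i.e. f(x) = Σ_{i=1}^n Σ_{j=1}^t f^i_j(x^i_j) with each f^i_j : ℝ → ℝ convex. Suppose the integer program min{f(x) : E^{(n)}x = b, l ≤ x ≤ u, x ∈ ℤ^{nt}} is feasible, and let x̂ be an optimal solution of its continuous relaxation min{f(x) : E^{(n)}x = b, l ≤ x ≤ u, x ∈ ℝ^{nt}}. Then there exists an optimal solution x* of the integer program with ‖x̂ − x*‖_∞ ≤ nt · max{‖g‖_∞ : g ∈ 𝒢(E^{(n)})}. -/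

import Mathlib

/-- Two integer vectors are sign-compatible if they lie in the same orthant. -/
def SignCompat {ι : Type*} (x y : ι → ℤ) : Prop := ∀ i, 0 ≤ x i * y i

/-- The conformal order: `y ⊑ x` iff `y` and `x` are sign-compatible and
`|y i| ≤ |x i|` for every coordinate. -/
def Conforms {ι : Type*} (y x : ι → ℤ) : Prop :=
  SignCompat y x ∧ ∀ i, |y i| ≤ |x i|

/-- The Graver basis of an integer matrix `A`: the set of `⊑`-minimal nonzero
elements of `ker_ℤ(A)`. -/
def GraverBasis {κ ι : Type*} [Fintype ι] (A : Matrix κ ι ℤ) : Set (ι → ℤ) :=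
  {g | g ≠ 0 ∧ A.mulVec g = 0 ∧
    ∀ h : ι → ℤ, h ≠ 0 → A.mulVec h = 0 → Conforms h g → h = g}

/-- The `n`-fold product `E^{(n)}` of the bimatrix `E = (D; A)`. -/
def nFold {r s t : ℕ} (n : ℕ) (D : Matrix (Fin r) (Fin t) ℤ)
    (A : Matrix (Fin s) (Fin t) ℤ) :
    Matrix (Fin r ⊕ (Fin n × Fin s)) (Fin n × Fin t) ℤ :=
  Matrix.of fun I q =>
    match I with
    | Sum.inl a => D a q.2
    | Sum.inr ia => if q.1 = ia.1 then A ia.2 q.2 else 0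

/-- The `1 × t` all-ones row matrix `1ᵀ`. -/
def onesRow (t : ℕ) : Matrix (Fin 1) (Fin t) ℤ := Matrix.of fun _ _ => 1

/-- A separable convex real function: a sum of univariate convex functions of
the individual coordinates. -/
def SepConvexR {ι : Type*} [Fintype ι] (f : (ι → ℝ) → ℝ) : Prop :=
  ∃ F : ι → ℝ → ℝ, (∀ i, ConvexOn ℝ Set.univ (F i)) ∧ ∀ x, f x = ∑ i, F i (x i)

/-- `max{‖g‖_∞ : g ∈ 𝒢(A)}` (as `sSup` in `ℕ`; the Graver basis is finite). -/
noncomputable def graverMaxInfNorm {κ ι : Type*} [Fintype ι] (A : Matrix κ ι ℤ) : ℕ :=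
  sSup {M : ℕ | ∃ v ∈ GraverBasis A, M = Finset.univ.sup fun i => (v i).natAbs}

theorem conforms_iff {ι : Type*} {x y : ι → ℤ} :
    Conforms x y ↔ ∀ i, (0 ≤ x i ∧ x i ≤ y i) ∨ (y i ≤ x i ∧ x i ≤ 0) := by
  unfold Conforms SignCompat
  rw [← forall_and]
  refine forall_congr' fun i => ⟨?_, ?_⟩
  · rintro ⟨h1, h2⟩
    rcases mul_nonneg_iff.1 h1 with ⟨ha, hb⟩ | ⟨ha, hb⟩
    · rw [abs_of_nonneg ha, abs_of_nonneg hb] at h2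
      exact Or.inl ⟨ha, h2⟩
    · rw [abs_of_nonpos ha, abs_of_nonpos hb] at h2
      exact Or.inr ⟨by omega, ha⟩
  · rintro (⟨h1, h2⟩ | ⟨h1, h2⟩)
    · exact ⟨mul_nonneg h1 (h1.trans h2), abs_le_abs_of_nonneg h1 h2⟩
    · exact ⟨mul_nonneg_of_nonpos_of_nonpos h2 (h1.trans h2), abs_le_abs_of_nonpos h2 h1⟩

theorem Conforms.trans {ι : Type*} {x y z : ι → ℤ} (hxy : Conforms x y) (hyz : Conforms y z) :
    Conforms x z := by
  rw [conforms_iff] at *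
  intro i
  have := hxy i
  have := hyz i
  omega

theorem graverBasis_finite {κ ι : Type*} [Fintype ι] (A : Matrix κ ι ℤ) :
    (GraverBasis A).Finite := by
  let φ : (ι → ℤ) → ι → ℕ × ℕ := fun z i => ((z i).toNat, (-z i).toNat)
  have hφ : φ.Injective := fun x y h => funext fun i => by
    have := congrFun h i
    simp only [φ, Prod.mk.injEq] at this
    omega
  refine Set.Finite.of_finite_image (f := φ) ?_ hφ.injOn
  refine WellQuasiOrderedLE.finite_of_isAntichain ?_
  rintro _ ⟨x, hx, rfl⟩ _ ⟨y, hy, rfl⟩ hne hle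
  refine hne (congrArg φ (hy.2.2 x hx.1 hx.2.1 (conforms_iff.2 fun i => ?_)))
  obtain ⟨h1, h2⟩ := Prod.mk_le_mk.1 (hle i)
  omega

theorem natAbs_le_graverMaxInfNorm {κ ι : Type*} [Fintype ι] {A : Matrix κ ι ℤ} {g : ι → ℤ}
    (hg : g ∈ GraverBasis A) (i : ι) : (g i).natAbs ≤ graverMaxInfNorm A := by
  have hbdd : BddAbove {M : ℕ | ∃ v ∈ GraverBasis A, M = Finset.univ.sup fun i => (v i).natAbs} := by
    refine (((graverBasis_finite A).image
      fun v => Finset.univ.sup fun i => (v i).natAbs).subset ?_).bddAbove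
    rintro _ ⟨v, hv, rfl⟩
    exact ⟨v, hv, rfl⟩
  exact (Finset.le_sup (f := fun i => (g i).natAbs) (Finset.mem_univ i)).trans
    (le_csSup hbdd ⟨g, hg, rfl⟩)

/-- Every nonzero integer kernel element dominates a Graver basis element. -/
theorem exists_graverBasis_conforms {κ ι : Type*} [Fintype ι] {A : Matrix κ ι ℤ} {z : ι → ℤ}
    (hz : z ≠ 0) (hAz : A.mulVec z = 0) : ∃ g ∈ GraverBasis A, Conforms g z := by
  obtain ⟨g, ⟨hg0, hAg, hgz⟩, hmin⟩ := exists_minimalFor_of_wellFoundedLT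
    (fun h : ι → ℤ => h ≠ 0 ∧ A.mulVec h = 0 ∧ Conforms h z) (fun h => ∑ i, (h i).natAbs)
    ⟨z, hz, hAz, conforms_iff.2 fun i => by omega⟩
  refine ⟨g, ⟨hg0, hAg, fun h hh0 hAh hhg => ?_⟩, hgz⟩
  have hc := conforms_iff.1 hhg
  have hle : ∀ i ∈ Finset.univ, (h i).natAbs ≤ (g i).natAbs := fun i _ => by
    have := hc i
    omega
  have hsum := (Finset.sum_le_sum hle).antisymm
    (hmin ⟨hh0, hAh, hhg.trans hgz⟩ (Finset.sum_le_sum hle))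
  have heq := (Finset.sum_eq_sum_iff_of_le hle).1 hsum
  funext i
  have := heq i (Finset.mem_univ i)
  have := hc i
  omega

/-- Simultaneous Diophantine approximation of finitely many reals. -/
theorem exists_nat_mul_sub_int_lt {ι : Type*} [Fintype ι] (y : ι → ℝ) {ε : ℝ} (hε : 0 < ε) :
    ∃ (q : ℕ) (p : ι → ℤ), 0 < q ∧ ∀ i, |q * y i - p i| < ε := by
  let x : ℕ → ι → ℝ := fun k i => Int.fract (k * y i)
  obtain ⟨a, -, φ, hφ, hlim⟩ := tendsto_subseq_of_bounded (x := x)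
    (Metric.isBounded_Icc (0 : ι → ℝ) 1)
    fun k => ⟨fun i => Int.fract_nonneg _, fun i => (Int.fract_lt_one _).le⟩
  obtain ⟨N, hN⟩ := Metric.cauchySeq_iff'.1 hlim.cauchySeq ε hε
  have hlt : φ N < φ (N + 1) := hφ (Nat.lt_succ_self N)
  refine ⟨φ (N + 1) - φ N, fun i => ⌊(φ (N + 1) : ℝ) * y i⌋ - ⌊(φ N : ℝ) * y i⌋,
    Nat.sub_pos_of_lt hlt, fun i => ?_⟩
  have h := (dist_le_pi_dist _ _ i).trans_lt (hN (N + 1) (Nat.le_succ N))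
  simp only [x, Function.comp_apply, Real.dist_eq, Int.fract] at h
  rw [Nat.cast_sub hlt.le]
  push_cast
  refine (congrArg abs ?_).trans_lt h
  ring

/-- A nonzero real kernel vector admits a nonzero integer kernel vector in the same orthant,
supported on its support. -/
theorem exists_int_mulVec_eq_zero {κ ι : Type*} [Finite κ] [Fintype ι] {A : Matrix κ ι ℤ}
    {y : ι → ℝ} (hy : y ≠ 0) (hAy : (A.map (Int.cast : ℤ → ℝ)).mulVec y = 0) :
    ∃ z : ι → ℤ, z ≠ 0 ∧ A.mulVec z = 0 ∧
      ∀ i, (0 ≤ y i → 0 ≤ z i) ∧ (y i ≤ 0 → z i ≤ 0) := by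
  obtain ⟨ε, ⟨hrow, hpos, hone⟩, hε⟩ : ∃ ε : ℝ, ((∀ k, (∑ j, |(A k j : ℝ)|) * ε < 1) ∧
      (∀ i, y i ≠ 0 → ε < |y i|) ∧ ε < 1) ∧ 0 < ε := by
    have hlim : Filter.Tendsto (fun ε : ℝ => ε) (nhdsWithin 0 (Set.Ioi 0)) (nhds 0) :=
      tendsto_nhdsWithin_of_tendsto_nhds Filter.tendsto_id
    refine Filter.Eventually.exists (f := nhdsWithin 0 (Set.Ioi 0))
      (((Filter.eventually_all.2 fun k => ?_).and ((Filter.eventually_all.2 fun i => ?_).and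
        (hlim.eventually_lt_const one_pos))).and self_mem_nhdsWithin)
    · have := hlim.const_mul (∑ j, |(A k j : ℝ)|)
      rw [mul_zero] at this
      exact this.eventually_lt_const one_pos
    · by_cases h : y i = 0
      · simp [h]
      · filter_upwards [hlim.eventually_lt_const (abs_pos.2 h)] with ε hε _ using hε
  obtain ⟨q, p, hq, hp⟩ := exists_nat_mul_sub_int_lt y hε
  have hq1 : (1 : ℝ) ≤ q := by exact_mod_cast hq
  have hsign : ∀ i, (0 < y i → 0 < p i) ∧ (y i < 0 → p i < 0) := fun i => by
    have h := abs_lt.1 (hp i)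
    refine ⟨fun hi => ?_, fun hi => ?_⟩
    · have h1 := hpos i hi.ne'
      rw [abs_of_pos hi] at h1
      have : (0 : ℝ) < p i := by nlinarith
      exact_mod_cast this
    · have h1 := hpos i hi.ne
      rw [abs_of_neg hi] at h1
      have : (p i : ℝ) < 0 := by nlinarith
      exact_mod_cast this
  have hzero : ∀ i, y i = 0 → p i = 0 := fun i hi => by
    have h := (hp i).trans hone
    rw [hi, mul_zero, zero_sub, abs_neg] at h
    exact Int.abs_lt_one_iff.1 (by exact_mod_cast h)
  refine ⟨p, fun h => ?_, funext fun k => ?_, fun i => ?_⟩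
  · obtain ⟨i, hi⟩ := Function.ne_iff.1 hy
    have hpi := congrFun h i
    rcases lt_or_gt_of_ne hi with hi | hi
    · exact ((hsign i).2 hi).ne hpi
    · exact ((hsign i).1 hi).ne' hpi
  · have hk : ∑ j, (A k j : ℝ) * y j = 0 := congrFun hAy k
    have hexp : ((A.mulVec p k : ℤ) : ℝ) = -∑ j, (A k j : ℝ) * (q * y j - p j) := by
      simp only [Matrix.mulVec, dotProduct, mul_sub, Finset.sum_sub_distrib, mul_left_comm _ (q : ℝ),
        ← Finset.mul_sum, hk]
      push_cast
      ring
    have hlt : |((A.mulVec p k : ℤ) : ℝ)| < 1 := by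
      rw [hexp, abs_neg]
      refine ((Finset.abs_sum_le_sum_abs _ _).trans ?_).trans_lt (hrow k)
      rw [Finset.sum_mul]
      refine Finset.sum_le_sum fun j _ => ?_
      rw [abs_mul]
      exact mul_le_mul_of_nonneg_left (hp j).le (abs_nonneg _)
    exact Int.abs_lt_one_iff.1 (by exact_mod_cast hlt)
  · rcases lt_trichotomy (y i) 0 with h | h | h
    · exact ⟨fun h' => absurd h h'.not_gt, fun _ => ((hsign i).2 h).le⟩
    · simp [hzero i h]
    · exact ⟨fun _ => ((hsign i).1 h).le, fun h' => absurd h h'.not_gt⟩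

theorem exists_graverBasis_sign {κ ι : Type*} [Finite κ] [Fintype ι] {A : Matrix κ ι ℤ}
    {y : ι → ℝ} (hy : y ≠ 0) (hAy : (A.map (Int.cast : ℤ → ℝ)).mulVec y = 0) :
    ∃ g ∈ GraverBasis A, ∀ i, (0 ≤ y i → 0 ≤ g i) ∧ (y i ≤ 0 → g i ≤ 0) := by
  obtain ⟨z, hz, hAz, hzy⟩ := exists_int_mulVec_eq_zero hy hAy
  obtain ⟨g, hg, hgz⟩ := exists_graverBasis_conforms hz hAz
  refine ⟨g, hg, fun i => ?_⟩
  have h := conforms_iff.1 hgz i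
  refine ⟨fun hi => ?_, fun hi => ?_⟩
  · have := (hzy i).1 hi
    omega
  · have := (hzy i).2 hi
    omega

theorem mulVec_intCast {κ ι : Type*} [Fintype ι] (A : Matrix κ ι ℤ) (z : ι → ℤ) :
    (A.map (Int.cast : ℤ → ℝ)).mulVec (fun i => (z i : ℝ)) = fun k => ((A.mulVec z k : ℤ) : ℝ) :=
  funext fun k => (RingHom.map_mulVec (Int.castRingHom ℝ) A z k).symm

/-- A real kernel vector that dominates no Graver basis element is small: it is a conformal
combination of at most as many Graver basis elements as the size of its support, all with
coefficients below one. -/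
theorem abs_le_card_support_mul_graverMaxInfNorm {κ ι : Type*} [Finite κ] [Fintype ι]
    {A : Matrix κ ι ℤ} (m : ℕ) (y : ι → ℝ) (hAy : (A.map (Int.cast : ℤ → ℝ)).mulVec y = 0)
    (hcard : (Finset.univ.filter fun i => y i ≠ 0).card ≤ m)
    (hno : ∀ g ∈ GraverBasis A, ¬ ∀ i, (g i : ℝ) ∈ Set.uIcc 0 (y i)) (i : ι) :
    |y i| ≤ m * graverMaxInfNorm A := by
  induction m generalizing y with
  | zero =>
    have := Finset.filter_eq_empty_iff.1 (Finset.card_eq_zero.1 (Nat.le_zero.1 hcard))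
      (Finset.mem_univ i)
    simp [not_not.1 this]
  | succ m ih =>
    by_cases hy : y = 0
    · simp only [hy, Pi.zero_apply, abs_zero]
      positivity
    obtain ⟨g, hg, hgy⟩ := exists_graverBasis_sign hy hAy
    obtain ⟨i₀, hi₀, hmin⟩ := Set.exists_min_image {i | g i ≠ 0} (fun i => y i / g i)
      (Set.toFinite _) (Function.ne_iff.1 hg.1)
    obtain ⟨c, hc⟩ : ∃ c, c = y i₀ / g i₀ := ⟨_, rfl⟩
    have hsign : ∀ i, 0 < g i ∧ 0 < y i ∨ g i < 0 ∧ y i < 0 ∨ g i = 0 := fun i => by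
      rcases lt_trichotomy (g i) 0 with h | h | h
      · exact Or.inr (Or.inl ⟨h, lt_of_not_ge fun h' => h.not_ge ((hgy i).1 h')⟩)
      · exact Or.inr (Or.inr h)
      · exact Or.inl ⟨h, lt_of_not_ge fun h' => h.not_ge ((hgy i).2 h')⟩
    have hc0 : 0 ≤ c := by
      rw [hc]
      rcases hsign i₀ with ⟨h1, h2⟩ | ⟨h1, h2⟩ | h
      · exact div_nonneg h2.le (by exact_mod_cast h1.le)
      · exact div_nonneg_of_nonpos h2.le (by exact_mod_cast h1.le)
      · exact absurd h hi₀
    have hcg : ∀ i, c * g i ∈ Set.uIcc 0 (y i) := fun i => by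
      rcases hsign i with ⟨h1, h2⟩ | ⟨h1, h2⟩ | h
      · have h1' : (0 : ℝ) < g i := by exact_mod_cast h1
        have := hmin i h1.ne'
        rw [← hc, le_div_iff₀ h1'] at this
        rw [Set.uIcc_of_le h2.le]
        exact ⟨by positivity, this⟩
      · have h1' : (g i : ℝ) < 0 := by exact_mod_cast h1
        have := hmin i h1.ne
        rw [← hc, le_div_iff_of_neg h1'] at this
        rw [Set.uIcc_of_ge h2.le]
        exact ⟨this, mul_nonpos_of_nonneg_of_nonpos hc0 h1'.le⟩
      · simp [h]
    have hc1 : c < 1 := by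
      by_contra! h1
      refine hno g hg fun i => ?_
      have := hcg i
      rw [Set.mem_uIcc] at this ⊢
      rcases hsign i with ⟨h2, h3⟩ | ⟨h2, h3⟩ | h
      · have h2' : (0 : ℝ) < g i := by exact_mod_cast h2
        left
        constructor
        · exact h2'.le
        · rcases this with h | h <;> nlinarith
      · have h2' : (g i : ℝ) < 0 := by exact_mod_cast h2
        right
        constructor
        · rcases this with h | h <;> nlinarith
        · exact h2'.le
      · simp [h, le_total]
    have hsub : ∀ i, y i - c * g i ∈ Set.uIcc 0 (y i) := fun i => by
      have := hcg i
      rw [Set.mem_uIcc] at this ⊢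
      rcases this with h | h
      · left; constructor <;> linarith
      · right; constructor <;> linarith
    have key := ih (fun i => y i - c * g i) ?_ ?_ ?_
    · have hgi : |(g i : ℝ)| ≤ graverMaxInfNorm A := by
        rw [← Int.cast_abs, Int.abs_eq_natAbs, Int.cast_natCast]
        exact_mod_cast natAbs_le_graverMaxInfNorm hg i
      have habs : |c * g i| ≤ graverMaxInfNorm A := by
        rw [abs_mul, abs_of_nonneg hc0]
        nlinarith [abs_nonneg (g i : ℝ)]
      calc |y i| = |(y i - c * g i) + c * g i| := by rw [sub_add_cancel]
        _ ≤ |y i - c * g i| + |c * g i| := abs_add_le _ _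
        _ ≤ m * graverMaxInfNorm A + graverMaxInfNorm A := add_le_add key habs
        _ = ((m + 1 : ℕ) : ℝ) * graverMaxInfNorm A := by push_cast; ring
    · have hAg := mulVec_intCast A g
      rw [hg.2.1] at hAg
      have : (fun i => y i - c * g i) = y - c • fun i => (g i : ℝ) := rfl
      rw [this, Matrix.mulVec_sub, Matrix.mulVec_smul, hAy, hAg]
      funext k
      simp
    · refine Nat.le_of_lt_succ (lt_of_lt_of_le (Finset.card_lt_card ?_) hcard)
      refine (Finset.ssubset_iff_of_subset fun i hi => ?_).2 ⟨i₀, ?_, ?_⟩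
      · simp only [Finset.mem_filter, Finset.mem_univ, true_and] at hi ⊢
        intro h
        have := hsub i
        rw [h, Set.uIcc_self, ← h] at this
        exact hi (this.trans h)
      · rcases hsign i₀ with ⟨h1, h2⟩ | ⟨h1, h2⟩ | h
        · simp [h2.ne']
        · simp [h2.ne]
        · exact absurd h hi₀
      · have : (g i₀ : ℝ) ≠ 0 := by exact_mod_cast hi₀
        simp [hc, this]
    · intro g' hg' h
      exact hno g' hg' fun i => Set.uIcc_subset_uIcc_left (hsub i) (h i)

theorem ConvexOn.map_add_add_map_sub_le {F : ℝ → ℝ} (hF : ConvexOn ℝ Set.univ F) {a b c : ℝ}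
    (hc : c ∈ Set.uIcc 0 (b - a)) : F (a + c) + F (b - c) ≤ F a + F b := by
  by_cases hab : b - a = 0
  · rw [hab, Set.uIcc_self] at hc
    simp [Set.mem_singleton_iff.1 hc]
  obtain ⟨θ, hθ⟩ : ∃ θ, θ = c / (b - a) := ⟨_, rfl⟩
  have hθc : c = θ * (b - a) := by rw [hθ, div_mul_cancel₀ _ hab]
  have h01 : 0 ≤ θ ∧ θ ≤ 1 := by
    rw [hθ]
    rw [Set.mem_uIcc] at hc
    rcases lt_or_gt_of_ne hab with h | h
    · exact ⟨div_nonneg_of_nonpos (by rcases hc with hc | hc <;> linarith) h.le,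
        (div_le_one_of_neg h).2 (by rcases hc with hc | hc <;> linarith)⟩
    · exact ⟨div_nonneg (by rcases hc with hc | hc <;> linarith) h.le,
        (div_le_one h).2 (by rcases hc with hc | hc <;> linarith)⟩
  have h1 := hF.2 (Set.mem_univ a) (Set.mem_univ b) (sub_nonneg.2 h01.2) h01.1 (by ring)
  have h2 := hF.2 (Set.mem_univ a) (Set.mem_univ b) h01.1 (sub_nonneg.2 h01.2) (by ring)
  simp only [smul_eq_mul] at h1 h2
  rw [show a + c = (1 - θ) * a + θ * b by rw [hθc]; ring,
    show b - c = θ * a + (1 - θ) * b by rw [hθc]; ring]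
  linarith

/-- Proximity for separable convex integer programs: every continuous optimum is within
`ℓ_∞`-distance `|ι| · max{‖g‖_∞ : g ∈ 𝒢(A)}` of some integer optimum. -/
theorem sepConvex_graver_proximity {κ ι : Type*} [Finite κ] [Fintype ι] (A : Matrix κ ι ℤ)
    (b : κ → ℤ) (l u : ι → ℤ) (f : (ι → ℝ) → ℝ) (hf : SepConvexR f)
    (hfeas : ∃ z : ι → ℤ, A.mulVec z = b ∧ (∀ q, l q ≤ z q) ∧ (∀ q, z q ≤ u q))
    (xhat : ι → ℝ)
    (hhat_eq : (A.map (Int.cast : ℤ → ℝ)).mulVec xhat = fun I => (b I : ℝ))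
    (hhat_l : ∀ q, (l q : ℝ) ≤ xhat q) (hhat_u : ∀ q, xhat q ≤ (u q : ℝ))
    (hhat_opt : ∀ z : ι → ℝ, (A.map (Int.cast : ℤ → ℝ)).mulVec z = (fun I => (b I : ℝ)) →
      (∀ q, (l q : ℝ) ≤ z q) → (∀ q, z q ≤ (u q : ℝ)) → f xhat ≤ f z) :
    ∃ xstar : ι → ℤ, A.mulVec xstar = b ∧ (∀ q, l q ≤ xstar q) ∧ (∀ q, xstar q ≤ u q) ∧
      (∀ z : ι → ℤ, A.mulVec z = b → (∀ q, l q ≤ z q) → (∀ q, z q ≤ u q) →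
        f (fun q => (xstar q : ℝ)) ≤ f (fun q => (z q : ℝ))) ∧
      (∀ q, |xhat q - (xstar q : ℝ)| ≤ Fintype.card ι * graverMaxInfNorm A) := by
  classical
  let S : Set (ι → ℤ) := {z | A.mulVec z = b ∧ (∀ q, l q ≤ z q) ∧ (∀ q, z q ≤ u q)}
  have hS : S.Finite := (Set.finite_Icc l u).subset fun z hz => ⟨hz.2.1, hz.2.2⟩
  obtain ⟨x₀, hx₀, hx₀min⟩ := Set.exists_min_image S (fun z => f fun q => (z q : ℝ)) hS hfeas
  let T : Set (ι → ℤ) := {z ∈ S | ∀ w ∈ S, f (fun q => (z q : ℝ)) ≤ f fun q => (w q : ℝ)}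
  obtain ⟨x, ⟨hxS, hxopt⟩, hxmin⟩ := Set.exists_min_image T (fun z => ∑ q, |xhat q - (z q : ℝ)|)
    (hS.subset fun z hz => hz.1) ⟨x₀, hx₀, hx₀min⟩
  refine ⟨x, hxS.1, hxS.2.1, hxS.2.2, fun z h1 h2 h3 => hxopt z ⟨h1, h2, h3⟩, ?_⟩
  refine abs_le_card_support_mul_graverMaxInfNorm (Fintype.card ι) (fun q => xhat q - (x q : ℝ)) ?_
    (Finset.card_le_univ _) fun g hg hgy => ?_
  · have hAx := mulVec_intCast A x
    rw [hxS.1] at hAx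
    exact (Matrix.mulVec_sub _ xhat fun q => (x q : ℝ)).trans (by rw [hhat_eq, hAx, sub_self])
  have hbetween : ∀ q, (0 ≤ (g q : ℝ) ∧ (x q : ℝ) + g q ≤ xhat q) ∨
      (xhat q ≤ x q + g q ∧ (g q : ℝ) ≤ 0) := fun q => by
    rcases Set.mem_uIcc.1 (hgy q) with h | h
    · left; constructor <;> linarith
    · right; constructor <;> linarith
  have hxl : ∀ q, (l q : ℝ) ≤ x q := fun q => by exact_mod_cast hxS.2.1 q
  have hxu : ∀ q, (x q : ℝ) ≤ u q := fun q => by exact_mod_cast hxS.2.2 q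
  have hx'S : x + g ∈ S := by
    refine ⟨by rw [Matrix.mulVec_add, hxS.1, hg.2.1, add_zero], fun q => ?_, fun q => ?_⟩
    · have : (l q : ℝ) ≤ x q + g q := by
        rcases hbetween q with h | h <;> linarith [hxl q, hhat_l q]
      exact_mod_cast this
    · have : (x q : ℝ) + g q ≤ u q := by
        rcases hbetween q with h | h <;> linarith [hxu q, hhat_u q]
      exact_mod_cast this
  have hhat' : f xhat ≤ f fun q => xhat q - (g q : ℝ) := by
    refine hhat_opt _ ?_ (fun q => ?_) fun q => ?_
    · have hAg := mulVec_intCast A g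
      rw [hg.2.1] at hAg
      refine (Matrix.mulVec_sub _ xhat fun q => (g q : ℝ)).trans ?_
      rw [hhat_eq, hAg]
      funext k
      simp
    · rcases hbetween q with h | h <;> linarith [hxl q, hhat_l q]
    · rcases hbetween q with h | h <;> linarith [hxu q, hhat_u q]
  have hle : f (fun q => ((x + g) q : ℝ)) ≤ f fun q => (x q : ℝ) := by
    obtain ⟨F, hF, hfF⟩ := hf
    have hsum := Finset.sum_le_sum fun q (_ : q ∈ Finset.univ) =>
      (hF q).map_add_add_map_sub_le (hgy q)
    simp only [Finset.sum_add_distrib] at hsum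
    rw [hfF, hfF] at hhat' ⊢
    simp only [Pi.add_apply, Int.cast_add]
    linarith
  have hcloser := hxmin (x + g) ⟨hx'S, fun w hw => hle.trans (hxopt w hw)⟩
  obtain ⟨q₀, hq₀⟩ := Function.ne_iff.1 hg.1
  refine hcloser.not_gt (Finset.sum_lt_sum (fun q _ => ?_) ⟨q₀, Finset.mem_univ _, ?_⟩)
  · rw [Pi.add_apply, Int.cast_add]
    rcases hbetween q with h | h
    · rw [abs_of_nonneg (by linarith), abs_of_nonneg (by linarith)]
      linarith
    · rw [abs_of_nonpos (by linarith), abs_of_nonpos (by linarith)]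
      linarith
  · rw [Pi.add_apply, Int.cast_add]
    have hq₀' : (g q₀ : ℝ) ≠ 0 := by exact_mod_cast hq₀
    rcases hbetween q₀ with h | h
    · have := lt_of_le_of_ne h.1 hq₀'.symm
      rw [abs_of_nonneg (by linarith), abs_of_nonneg (by linarith)]
      linarith
    · have := lt_of_le_of_ne h.2 hq₀'
      rw [abs_of_nonpos (by linarith), abs_of_nonpos (by linarith)]
      linarith

/-- Proximity for combinatorial `n`-fold IPs: any optimum `x̂` of the continuous
relaxation is within `ℓ_∞`-distance `nt · max{‖g‖_∞ : g ∈ 𝒢(E^{(n)})}` of some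
optimal integer solution `x*`. -/
theorem comb_nfold_proximity {r t n : ℕ}
    (D : Matrix (Fin r) (Fin t) ℤ)
    (b : Fin r ⊕ (Fin n × Fin 1) → ℤ) (l u : Fin n × Fin t → ℤ)
    (hlu : ∀ q, l q ≤ u q)
    (f : (Fin n × Fin t → ℝ) → ℝ) (hf : SepConvexR f)
    (hfeas : ∃ z : Fin n × Fin t → ℤ,
      (nFold n D (onesRow t)).mulVec z = b ∧ (∀ q, l q ≤ z q) ∧ (∀ q, z q ≤ u q))
    (xhat : Fin n × Fin t → ℝ)
    (hhat_eq : ((nFold n D (onesRow t)).map (Int.cast : ℤ → ℝ)).mulVec xhat =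
      fun I => (b I : ℝ))
    (hhat_l : ∀ q, (l q : ℝ) ≤ xhat q) (hhat_u : ∀ q, xhat q ≤ (u q : ℝ))
    (hhat_opt : ∀ z : Fin n × Fin t → ℝ,
      ((nFold n D (onesRow t)).map (Int.cast : ℤ → ℝ)).mulVec z = (fun I => (b I : ℝ)) →
      (∀ q, (l q : ℝ) ≤ z q) → (∀ q, z q ≤ (u q : ℝ)) → f xhat ≤ f z) :
    ∃ xstar : Fin n × Fin t → ℤ,
      (nFold n D (onesRow t)).mulVec xstar = b ∧
      (∀ q, l q ≤ xstar q) ∧ (∀ q, xstar q ≤ u q) ∧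
      (∀ z : Fin n × Fin t → ℤ,
        (nFold n D (onesRow t)).mulVec z = b → (∀ q, l q ≤ z q) → (∀ q, z q ≤ u q) →
        f (fun q => (xstar q : ℝ)) ≤ f (fun q => (z q : ℝ))) ∧
      (∀ q, |xhat q - (xstar q : ℝ)| ≤
        (n : ℝ) * t * graverMaxInfNorm (nFold n D (onesRow t))) := by
  simpa using sepConvex_graver_proximity (nFold n D (onesRow t)) b l u f hf hfeas xhat hhat_eq
    hhat_l hhat_u hhat_opt
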